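/- arXiv:2407.20659 — 2 statements merged into one kernel-verified Lean document; each statement's English description precedes it below -/
import Mathlib

section
/- Let Γ_1, Γ_2 ⊆ ℝ be finite nonempty sets (the x-coordinates of vertical grid lines and the y-coordinates of horizontal grid lines). Let S be a finite family of closed axis-aligned rectangles in ℝ², each stabbed along both axes, i.e., for each rectangle [l,r]×[b,t] in S there exist γ ∈ Γ_1 with l ≤ γ ≤ r and γ′ ∈ Γ_2 with b ≤ γ′ ≤ t. Say two rectangles of S are equivalent if they intersect exactly the same set of grid cells, and let rep : S → S be a function with rep(s) equivalent to s for every s ∈ S. Let I ⊆ S be a subfamily of pairwise disjoint rectangles. Then for every point p ∈ ℝ², at most 4 rectangles s ∈ I satisfy p ∈ rep(s). -/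
/-- Two reals lie in the same grid column determined by the finite set `Γ` of
grid coordinates (the columns are the half-open intervals into which the points
of `Γ` subdivide `ℝ`). -/
def SameCol (Γ : Finset ℝ) (x y : ℝ) : Prop := ∀ γ ∈ Γ, (γ ≤ x ↔ γ ≤ y)

/-- The closed axis-aligned rectangle `[s.1 0, s.2 0] × [s.1 1, s.2 1]`
(points of `ℝ²` being represented as functions `Fin 2 → ℝ`). -/
def boxSet (s : (Fin 2 → ℝ) × (Fin 2 → ℝ)) : Set (Fin 2 → ℝ) :=
  {x | ∀ k, s.1 k ≤ x k ∧ x k ≤ s.2 k}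

/-- The grid cell (a product of one column per axis, w.r.t. the grid
coordinates `Γ k` on the `k`-th axis) containing the point `p`. -/
def cellOf (Γ : Fin 2 → Finset ℝ) (p : Fin 2 → ℝ) : Set (Fin 2 → ℝ) :=
  {q | ∀ k, SameCol (Γ k) (p k) (q k)}

/-- Any interval that contains a grid coordinate and meets the column of `p` contains one of
the two grid coordinates adjacent to `p`. -/
theorem exists_pair_stabbing_of_meets_column (Γ : Finset ℝ) (p : ℝ) :
    ∃ c : Bool → ℝ, ∀ l r : ℝ, (∃ γ ∈ Γ, l ≤ γ ∧ γ ≤ r) →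
      (∃ x, (l ≤ x ∧ x ≤ r) ∧ SameCol Γ p x) → ∃ i, l ≤ c i ∧ c i ≤ r := by
  have below : ∃ a, ∀ γ ∈ Γ, γ ≤ p → γ ≤ a ∧ a ∈ Γ ∧ a ≤ p := by
    by_cases h : (Γ.filter (· ≤ p)).Nonempty
    · obtain ⟨a, ha, hmax⟩ := Finset.exists_max_image _ id h
      rw [Finset.mem_filter] at ha
      exact ⟨a, fun γ hγ hγp => ⟨hmax γ (Finset.mem_filter.2 ⟨hγ, hγp⟩), ha⟩⟩
    · exact ⟨0, fun γ hγ hγp => (h ⟨γ, Finset.mem_filter.2 ⟨hγ, hγp⟩⟩).elim⟩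
  have above : ∃ b, ∀ γ ∈ Γ, p < γ → b ≤ γ ∧ b ∈ Γ ∧ p < b := by
    by_cases h : (Γ.filter (p < ·)).Nonempty
    · obtain ⟨b, hb, hmin⟩ := Finset.exists_min_image _ id h
      rw [Finset.mem_filter] at hb
      exact ⟨b, fun γ hγ hγp => ⟨hmin γ (Finset.mem_filter.2 ⟨hγ, hγp⟩), hb⟩⟩
    · exact ⟨0, fun γ hγ hγp => (h ⟨γ, Finset.mem_filter.2 ⟨hγ, hγp⟩⟩).elim⟩
  obtain ⟨a, ha⟩ := below
  obtain ⟨b, hb⟩ := above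
  refine ⟨fun i => if i then a else b, ?_⟩
  rintro l r ⟨γ, hγ, hl, hr⟩ ⟨x, ⟨hlx, hxr⟩, hx⟩
  rcases le_or_gt γ p with h | h
  · obtain ⟨hγa, haΓ, hap⟩ := ha γ hγ h
    exact ⟨true, by simpa using ⟨hl.trans hγa, ((hx a haΓ).1 hap).trans hxr⟩⟩
  · obtain ⟨hbγ, hbΓ, hpb⟩ := hb γ hγ h
    have hxb : x < b := lt_of_not_ge fun hbx => hpb.not_ge ((hx b hbΓ).2 hbx)
    exact ⟨false, by simpa using ⟨hlx.trans hxb.le, hbγ.trans hr⟩⟩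

/-- Bounded-depth lemma for rounding rectangles: if every rectangle of `S` is
stabbed along both axes, `rep` maps each rectangle of `S` to a rectangle of `S`
intersecting exactly the same grid cells, and `I ⊆ S` consists of pairwise
disjoint rectangles, then every point `p` lies in `rep s` for at most `4`
rectangles `s ∈ I`. -/
theorem stmt2 (Γ : Fin 2 → Finset ℝ) (hΓ : ∀ k, (Γ k).Nonempty)
    (S : Finset ((Fin 2 → ℝ) × (Fin 2 → ℝ)))
    (hstab : ∀ s ∈ S, ∀ k, ∃ γ ∈ Γ k, s.1 k ≤ γ ∧ γ ≤ s.2 k)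
    (rep : (Fin 2 → ℝ) × (Fin 2 → ℝ) → (Fin 2 → ℝ) × (Fin 2 → ℝ))
    (hrepS : ∀ s ∈ S, rep s ∈ S)
    (hrep : ∀ s ∈ S, ∀ p : Fin 2 → ℝ,
      ((boxSet s ∩ cellOf Γ p).Nonempty ↔ (boxSet (rep s) ∩ cellOf Γ p).Nonempty))
    (I : Finset ((Fin 2 → ℝ) × (Fin 2 → ℝ))) (hIS : I ⊆ S)
    (hdisj : ∀ s ∈ I, ∀ t ∈ I, s ≠ t → boxSet s ∩ boxSet t = ∅)
    (p : Fin 2 → ℝ) :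
    {s | s ∈ I ∧ p ∈ boxSet (rep s)}.ncard ≤ 4 := by
  choose c hc using fun k => exists_pair_stabbing_of_meets_column (Γ k) (p k)
  have corner : ∀ s, ∃ f : Fin 2 → Bool, s ∈ I ∧ p ∈ boxSet (rep s) →
      (fun k => c k (f k)) ∈ boxSet s := by
    intro s
    by_cases hs : s ∈ I ∧ p ∈ boxSet (rep s)
    · obtain ⟨x, hxs, hxp⟩ := (hrep s (hIS hs.1) p).2 ⟨p, hs.2, fun _ _ _ => Iff.rfl⟩
      choose f hf using fun k =>
        hc k (s.1 k) (s.2 k) (hstab s (hIS hs.1) k) ⟨x k, hxs k, hxp k⟩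
      exact ⟨f, fun _ => hf⟩
    · exact ⟨fun _ => true, fun h => (hs h).elim⟩
  choose F hF using corner
  have hinj : Set.InjOn F {s | s ∈ I ∧ p ∈ boxSet (rep s)} := by
    intro s hs t ht hst
    by_contra hne
    have hmem : (fun k => c k (F s k)) ∈ boxSet s ∩ boxSet t :=
      ⟨hF s hs, by rw [hst]; exact hF t ht⟩
    rw [hdisj s hs.1 t ht.1 hne] at hmem
    exact hmem
  calc {s | s ∈ I ∧ p ∈ boxSet (rep s)}.ncard
      ≤ (Set.univ : Set (Fin 2 → Bool)).ncard :=
        Set.ncard_le_ncard_of_injOn F (fun _ _ => Set.mem_univ _) hinj Set.finite_univ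
    _ = 4 := by simp [Set.ncard_univ]
end

section
/- Let Γ_1, Γ_2 ⊆ ℝ be finite nonempty sets defining a grid in ℝ². Let s = [l,r]×[b,t] and s′ = [l′,r′]×[b′,t′] be closed axis-aligned rectangles, each stabbed along both axes, with s ∩ s′ = ∅. Let ŝ and ŝ′ be closed axis-aligned rectangles such that ŝ intersects exactly the same set of grid cells as s and ŝ′ intersects exactly the same set of grid cells as s′. If ŝ ∩ ŝ′ ≠ ∅, then ξ⁺(s) = ξ⁻(s′), or ξ⁺(s′) = ξ⁻(s), or η⁺(s) = η⁻(s′), or η⁺(s′) = η⁻(s). -/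
/-- Grid columns are order-convex: if `x` and `y` share a column, then so do any two ordered
points between them. -/
lemma SameCol.of_between {Γ : Finset ℝ} {p x y a b : ℝ} (hx : SameCol Γ p x)
    (hy : SameCol Γ p y) (hxa : x ≤ a) (hab : a ≤ b) (hby : b ≤ y) : SameCol Γ a b :=
  fun γ hγ ↦ ⟨fun h ↦ h.trans hab, fun h ↦
    ((hx γ hγ).1 ((hy γ hγ).2 (h.trans hby))).trans hxa⟩

/-- Two disjoint nonempty boxes are separated along one of the axes. -/
lemma exists_lt_of_boxSet_inter_eq_empty {s s' : (Fin 2 → ℝ) × (Fin 2 → ℝ)}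
    (hs : ∀ k, s.1 k ≤ s.2 k) (hs' : ∀ k, s'.1 k ≤ s'.2 k)
    (hdisj : boxSet s ∩ boxSet s' = ∅) : ∃ k, s.2 k < s'.1 k ∨ s'.2 k < s.1 k := by
  by_contra! h
  refine Set.notMem_empty (fun k ↦ max (s.1 k) (s'.1 k)) (hdisj ▸ ⟨fun k ↦ ?_, fun k ↦ ?_⟩)
  · exact ⟨le_max_left _ _, max_le (hs k) (h k).1⟩
  · exact ⟨le_max_right _ _, max_le (h k).2 (hs' k)⟩

/-- Let `s = [l,r]×[b,t]` and `s' = [l',r']×[b',t']` be disjoint rectangles,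
each stabbed along both axes, and let `t`, `t'` be rectangles intersecting
exactly the same grid cells as `s`, `s'` respectively.  If `t ∩ t' ≠ ∅`, then
`ξ⁺(s) = ξ⁻(s')` or `ξ⁺(s') = ξ⁻(s)` or `η⁺(s) = η⁻(s')` or `η⁺(s') = η⁻(s)`
(columns `ξ^±` of the right/left edges and rows `η^±` of the top/bottom edges
coinciding being expressed via `SameCol`). -/
theorem stmt4 (Γ : Fin 2 → Finset ℝ) (hΓ : ∀ k, (Γ k).Nonempty)
    (s s' : (Fin 2 → ℝ) × (Fin 2 → ℝ))
    (hstab : ∀ k, ∃ γ ∈ Γ k, s.1 k ≤ γ ∧ γ ≤ s.2 k)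
    (hstab' : ∀ k, ∃ γ ∈ Γ k, s'.1 k ≤ γ ∧ γ ≤ s'.2 k)
    (hdisj : boxSet s ∩ boxSet s' = ∅)
    (t t' : (Fin 2 → ℝ) × (Fin 2 → ℝ))
    (ht : ∀ p, (boxSet s ∩ cellOf Γ p).Nonempty ↔ (boxSet t ∩ cellOf Γ p).Nonempty)
    (ht' : ∀ p, (boxSet s' ∩ cellOf Γ p).Nonempty ↔ (boxSet t' ∩ cellOf Γ p).Nonempty)
    (hint : (boxSet t ∩ boxSet t').Nonempty) :
    SameCol (Γ 0) (s.2 0) (s'.1 0) ∨ SameCol (Γ 0) (s'.2 0) (s.1 0) ∨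
      SameCol (Γ 1) (s.2 1) (s'.1 1) ∨ SameCol (Γ 1) (s'.2 1) (s.1 1) := by
  obtain ⟨x, hxt, hxt'⟩ := hint
  obtain ⟨y, hy, hxy⟩ := (ht x).2 ⟨x, hxt, fun _ _ _ ↦ Iff.rfl⟩
  obtain ⟨y', hy', hxy'⟩ := (ht' x).2 ⟨x, hxt', fun _ _ _ ↦ Iff.rfl⟩
  obtain ⟨k, hk⟩ := exists_lt_of_boxSet_inter_eq_empty
    (fun k ↦ (hy k).1.trans (hy k).2) (fun k ↦ (hy' k).1.trans (hy' k).2) hdisj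
  have key : SameCol (Γ k) (s.2 k) (s'.1 k) ∨ SameCol (Γ k) (s'.2 k) (s.1 k) :=
    hk.imp (fun h ↦ (hxy k).of_between (hxy' k) (hy k).2 h.le (hy' k).1)
      (fun h ↦ (hxy' k).of_between (hxy k) (hy' k).2 h.le (hy k).1)
  fin_cases k
  · exact key.elim Or.inl fun h ↦ Or.inr (Or.inl h)
  · exact Or.inr (Or.inr key)
end
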